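/- arXiv:2511.17272 — 2 statements merged into one kernel-verified Lean document; each statement's English description precedes it below -/
import Mathlib

section
/- Let F be a field, A and T finite sets, D a positive integer, P a set of polynomials in F[x_{A,T}] that contains the polynomial (Σ_{i∈T} x_{a,i}) - 1 for every a in A, and R a degree-D pseudo-reduction operator for P. Then for all subsets Y ⊆ X ⊆ A with |X| ≤ D and every function ψ: Y → T, the sum of R(m_φ) over all functions φ: X → T whose restriction to Y equals ψ is equal to R(m_ψ). -/
attribute [local instance] Classical.propDecidable

namespace MvPolynomial

variable {F σ : Type*} [Field F]

/-- The recursion `R (x * m) = R (x * R m)` extends linearly from monomials `m` to polynomials. -/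
theorem map_X_mul_of_totalDegree_le {n : ℕ} (R : MvPolynomial σ F →ₗ[F] MvPolynomial σ F)
    (hR : ∀ d : σ →₀ ℕ, (d.sum fun _ e => e) ≤ n → ∀ v : σ,
      R (X v * monomial d 1) = R (X v * R (monomial d 1)))
    (q : MvPolynomial σ F) (hq : q.totalDegree ≤ n) (v : σ) :
    R (X v * q) = R (X v * R q) := by
  rw [q.as_sum]
  simp only [map_sum, Finset.mul_sum]
  refine Finset.sum_congr rfl fun d hd => ?_
  have hmon : monomial d (coeff d q) = coeff d q • (monomial d 1 : MvPolynomial σ F) := by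
    rw [smul_monomial, smul_eq_mul, mul_one]
  rw [hmon, map_smul, mul_smul_comm, mul_smul_comm, map_smul, map_smul,
    hR d ((le_totalDegree hd).trans hq) v]

theorem map_monomial_mul_eq_zero {n : ℕ} (R : MvPolynomial σ F →ₗ[F] MvPolynomial σ F)
    (hR : ∀ d : σ →₀ ℕ, (d.sum fun _ e => e) ≤ n → ∀ v : σ,
      R (X v * monomial d 1) = R (X v * R (monomial d 1)))
    (p : MvPolynomial σ F) (hp : p.totalDegree ≤ 1) (hRp : R p = 0)
    (k : ℕ) (hk : k ≤ n) (d : σ →₀ ℕ) (hd : (d.sum fun _ e => e) = k) :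
    R (monomial d 1 * p) = 0 := by
  induction k generalizing d with
  | zero =>
    have hd0 : d = 0 := by
      ext v
      by_contra hv
      have := Finset.single_le_sum (f := d) (fun _ _ => Nat.zero_le _)
        (Finsupp.mem_support_iff.2 hv)
      simp only [Finsupp.sum] at hd
      simp_all
    subst hd0
    simpa using hRp
  | succ k ih =>
    obtain ⟨v, hv⟩ : ∃ v, d v ≠ 0 := by
      by_contra! h
      obtain rfl : d = 0 := Finsupp.ext h
      simp at hd
    have hsplit : Finsupp.single v 1 + (d - Finsupp.single v 1) = d :=
      add_tsub_cancel_of_le (Finsupp.single_le_iff.2 (Nat.one_le_iff_ne_zero.2 hv))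
    obtain ⟨e, he⟩ : ∃ e, Finsupp.single v 1 + e = d := ⟨_, hsplit⟩
    have hdeg : (e.sum fun _ e => e) = k := by
      rw [← he, Finsupp.sum_add_index' (fun _ => rfl) (fun _ _ _ => rfl),
        Finsupp.sum_single_index rfl] at hd
      omega
    have hmon : (monomial d 1 : MvPolynomial σ F) = X v * monomial e 1 := by
      rw [X, monomial_mul, he, one_mul]
    have htot : (monomial e 1 * p).totalDegree ≤ n := by
      refine (totalDegree_mul _ _).trans ?_
      rw [totalDegree_monomial e one_ne_zero, hdeg]
      omega
    rw [hmon, mul_assoc, map_X_mul_of_totalDegree_le R hR _ htot, ih (by omega) e hdeg, mul_zero,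
      map_zero]

theorem map_mul_eq_zero_of_totalDegree_le {n : ℕ} (R : MvPolynomial σ F →ₗ[F] MvPolynomial σ F)
    (hR : ∀ d : σ →₀ ℕ, (d.sum fun _ e => e) ≤ n → ∀ v : σ,
      R (X v * monomial d 1) = R (X v * R (monomial d 1)))
    (p : MvPolynomial σ F) (hp : p.totalDegree ≤ 1) (hRp : R p = 0)
    (q : MvPolynomial σ F) (hq : q.totalDegree ≤ n) :
    R (q * p) = 0 := by
  rw [q.as_sum, Finset.sum_mul, map_sum]
  refine Finset.sum_eq_zero fun d hd => ?_
  have hmon : monomial d (coeff d q) = coeff d q • (monomial d 1 : MvPolynomial σ F) := by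
    rw [smul_monomial, smul_eq_mul, mul_one]
  rw [hmon, smul_mul_assoc, map_smul,
    map_monomial_mul_eq_zero R hR p hp hRp _ ((le_totalDegree hd).trans hq) d rfl, smul_zero]

/-- Factors `s a` of degree at most one with `R (s a - 1) = 0` can be dropped under `R` as long as
the total degree does not exceed `n + 1`. -/
theorem map_mul_prod_eq {ι : Type*} {n : ℕ} (R : MvPolynomial σ F →ₗ[F] MvPolynomial σ F)
    (hR : ∀ d : σ →₀ ℕ, (d.sum fun _ e => e) ≤ n → ∀ v : σ,
      R (X v * monomial d 1) = R (X v * R (monomial d 1)))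
    (s : ι → MvPolynomial σ F) (hs : ∀ a, (s a).totalDegree ≤ 1) (hRs : ∀ a, R (s a - 1) = 0)
    (m : MvPolynomial σ F) (Z : Finset ι) (hm : m.totalDegree + Z.card ≤ n + 1) :
    R (m * ∏ a ∈ Z, s a) = R m := by
  induction Z using Finset.induction_on with
  | empty => simp
  | insert a Z ha ih =>
    rw [Finset.card_insert_of_notMem ha] at hm
    have hprod : (∏ b ∈ Z, s b).totalDegree ≤ Z.card :=
      (totalDegree_finsetProd _ _).trans
        ((Finset.sum_le_card_nsmul _ _ 1 fun b _ => hs b).trans (by simp))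
    have hq : (m * ∏ b ∈ Z, s b).totalDegree ≤ n := (totalDegree_mul _ _).trans (by omega)
    have hp : (s a - 1).totalDegree ≤ 1 := (totalDegree_sub _ _).trans (by simp [hs a])
    have hzero := map_mul_eq_zero_of_totalDegree_le R hR _ hp (hRs a) _ hq
    rw [mul_sub, mul_one, map_sub, sub_eq_zero] at hzero
    rw [Finset.prod_insert ha, mul_left_comm, mul_comm (s a), hzero, ih (by omega)]

end MvPolynomial

/-- If `P` contains the polynomials `(Σ_{i∈T} x_{a,i}) - 1` and `R` is a degree-`D`
pseudo-reduction operator for `P`, then for `Y ⊆ X ⊆ A` with `|X| ≤ D` and `ψ : Y → T`,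
the sum of `R(m_φ)` over all `φ : X → T` restricting to `ψ` on `Y` equals `R(m_ψ)`. -/
theorem pseudo_reduction_marginal {F A T : Type*} [Field F] [Fintype A] [Fintype T]
    [DecidableEq A]
    (D : ℕ) (hD : 0 < D)
    (P : Set (MvPolynomial (A × T) F))
    (hP : ∀ a : A, ((∑ i : T, MvPolynomial.X (a, i)) - 1 : MvPolynomial (A × T) F) ∈ P)
    (R : MvPolynomial (A × T) F →ₗ[F] MvPolynomial (A × T) F)
    (hR1 : R 1 = 1)
    (hR2 : ∀ p ∈ P, R p = 0)
    (hR3 : ∀ d : A × T →₀ ℕ, (d.sum fun _ e => e) ≤ D - 1 → ∀ v : A × T,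
      R (MvPolynomial.X v * MvPolynomial.monomial d 1) =
        R (MvPolynomial.X v * R (MvPolynomial.monomial d 1)))
    (Y X : Finset A) (hYX : Y ⊆ X) (hX : X.card ≤ D)
    (ψ : ↥Y → T) :
    ∑ φ ∈ Finset.univ.filter
        (fun φ : ↥X → T => ∀ (a : A) (ha : a ∈ Y), φ ⟨a, hYX ha⟩ = ψ ⟨a, ha⟩),
      R (∏ a : ↥X, MvPolynomial.X ((a : A), φ a)) =
      R (∏ a : ↥Y, MvPolynomial.X ((a : A), ψ a)) := by
  let S : A → MvPolynomial (A × T) F := fun a => ∑ i : T, MvPolynomial.X (a, i)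
  let g : A → MvPolynomial (A × T) F := fun a =>
    if ha : a ∈ Y then MvPolynomial.X (a, ψ ⟨a, ha⟩) else S a
  let t : ↥X → Finset T := fun a =>
    if ha : (a : A) ∈ Y then {ψ ⟨a, ha⟩} else Finset.univ
  have hfilter : Finset.univ.filter
      (fun φ : ↥X → T => ∀ (a : A) (ha : a ∈ Y), φ ⟨a, hYX ha⟩ = ψ ⟨a, ha⟩) =
      Fintype.piFinset t := by
    ext φ
    simp only [Finset.mem_filter, Finset.mem_univ, true_and, Fintype.mem_piFinset]
    refine ⟨fun h a => ?_, fun h a ha => ?_⟩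
    · by_cases ha : (a : A) ∈ Y
      · simpa [t, ha] using h a ha
      · simp [t, ha]
    · simpa [t, ha] using h ⟨a, hYX ha⟩
  have hsum : ∑ φ ∈ Fintype.piFinset t,
      ∏ a : ↥X, (MvPolynomial.X ((a : A), φ a) : MvPolynomial (A × T) F) = ∏ a ∈ X, g a := by
    rw [← Finset.prod_univ_sum t fun a i => MvPolynomial.X ((a : A), i), ← Finset.prod_coe_sort X g]
    refine Finset.prod_congr rfl fun a _ => ?_
    by_cases ha : (a : A) ∈ Y <;> simp [t, g, S, ha]
  have hY : ∏ a ∈ Y, g a = ∏ a : ↥Y, MvPolynomial.X ((a : A), ψ a) := by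
    rw [← Finset.prod_coe_sort Y g]
    exact Finset.prod_congr rfl fun a _ => by simp [g]
  have hZ : ∏ a ∈ X \ Y, g a = ∏ a ∈ X \ Y, S a :=
    Finset.prod_congr rfl fun a ha => by simp [g, (Finset.mem_sdiff.1 ha).2]
  have hdeg : (∏ a : ↥Y, (MvPolynomial.X ((a : A), ψ a) : MvPolynomial (A × T) F)).totalDegree
      ≤ Y.card :=
    (MvPolynomial.totalDegree_finsetProd _ _).trans (by simp)
  have hcard := Finset.card_sdiff_add_card_eq_card hYX
  rw [← map_sum, hfilter, hsum, ← Finset.prod_sdiff hYX, hY, hZ, mul_comm]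
  exact MvPolynomial.map_mul_prod_eq R hR3 S
    (fun a => MvPolynomial.totalDegree_finsetSum_le fun i _ => by simp)
    (fun a => hR2 _ (hP a)) _ _ (by omega)
end

section
/- Let F be a field of characteristic zero, n a natural number, and V a subset of {0,1}^n ⊆ F^n. Then for every monomial m in F[x_1,...,x_n], the reduction of m modulo the vanishing ideal I(V), taken with respect to the lexicographic order induced by x_1 ≻ x_2 ≻ ... ≻ x_n, has all of its coefficients in the image of ℤ in F. -/
def IsLeadingMonomialOf {σ F : Type*} [CommSemiring F]
    (r : (σ →₀ ℕ) → (σ →₀ ℕ) → Prop) (d : σ →₀ ℕ) (p : MvPolynomial σ F) : Prop :=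
  d ∈ p.support ∧ ∀ e ∈ p.support, e ≠ d → r e d

def Reducible {σ F : Type*} [CommSemiring F] (r : (σ →₀ ℕ) → (σ →₀ ℕ) → Prop)
    (I : Ideal (MvPolynomial σ F)) (d : σ →₀ ℕ) : Prop :=
  ∃ q ∈ I, q ≠ 0 ∧ IsLeadingMonomialOf r d q

/-- `red` is the reduction of `p` modulo `I`. -/
def IsReductionOf {σ F : Type*} [CommRing F] (r : (σ →₀ ℕ) → (σ →₀ ℕ) → Prop)
    (I : Ideal (MvPolynomial σ F)) (p red : MvPolynomial σ F) : Prop :=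
  p - red ∈ I ∧ ∀ d ∈ red.support, ¬ Reducible r I d

/-- The lexicographic order on monomials induced by `x_1 ≻ x_2 ≻ ... ≻ x_n`:
`d ≺ e` iff at the leftmost variable where they differ, `e` has the larger exponent. -/
def LexLtFin {n : ℕ} (d e : Fin n →₀ ℕ) : Prop :=
  ∃ v : Fin n, d v < e v ∧ ∀ w : Fin n, w < v → d w = e w

/-- The ideal of polynomials vanishing at every point of `V` (the whole ring if `V = ∅`). -/
def vanishingIdeal {F : Type*} [Field F] {n : ℕ} (V : Set (Fin n → F)) :
    Ideal (MvPolynomial (Fin n) F) where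
  carrier := {p | ∀ x ∈ V, MvPolynomial.eval x p = 0}
  add_mem' := by
    intro p q hp hq x hx
    simp [map_add, hp x hx, hq x hx]
  zero_mem' := by
    intro x hx
    simp
  smul_mem' := by
    intro c p hp x hx
    simp [smul_eq_mul, map_mul, hp x hx]

theorem lexLtFin_iff_toLex_lt {n : ℕ} (d e : Fin n →₀ ℕ) :
    LexLtFin d e ↔ toLex d < toLex e := by
  rw [Finsupp.Lex.lt_iff]
  simp only [LexLtFin, ofLex_toLex]
  exact exists_congr fun _ => and_comm

/-- Every nonzero polynomial has a lexicographically largest monomial. -/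
theorem exists_isLeadingMonomialOf {F : Type*} [CommSemiring F] {n : ℕ}
    {p : MvPolynomial (Fin n) F} (hp : p ≠ 0) : ∃ d, IsLeadingMonomialOf LexLtFin d p := by
  obtain ⟨d, hd, hmax⟩ := Finset.exists_max_image p.support toLex
    (MvPolynomial.support_nonempty.mpr hp)
  refine ⟨d, hd, fun e he hne => ?_⟩
  rw [lexLtFin_iff_toLex_lt]
  exact lt_of_le_of_ne (hmax e he) (toLex.injective.ne hne)

theorem IsReductionOf.unique {F : Type*} [CommRing F] {n : ℕ}
    {I : Ideal (MvPolynomial (Fin n) F)} {p r s : MvPolynomial (Fin n) F}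
    (hr : IsReductionOf LexLtFin I p r) (hs : IsReductionOf LexLtFin I p s) : r = s := by
  by_contra hne
  have hmem : r - s ∈ I := by simpa using I.sub_mem hs.1 hr.1
  obtain ⟨d, hd⟩ := exists_isLeadingMonomialOf (sub_ne_zero.mpr hne)
  have hred : Reducible LexLtFin I d := ⟨r - s, hmem, sub_ne_zero.mpr hne, hd⟩
  classical
  rcases Finset.mem_union.mp (MvPolynomial.support_sub _ r s hd.1) with h | h
  · exact hr.2 d h hred
  · exact hs.2 d h hred

theorem lexLtFin_cons {n : ℕ} {i j : ℕ} {d e : Fin n →₀ ℕ} :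
    LexLtFin (d.cons i) (e.cons j) ↔ i < j ∨ i = j ∧ LexLtFin d e := by
  simp only [LexLtFin, Fin.exists_fin_succ, Fin.forall_fin_succ, Finsupp.cons_zero,
    Finsupp.cons_succ, Fin.succ_lt_succ_iff, Fin.succ_pos, Fin.not_lt_zero, lt_irrefl]
  simp only [false_imp_iff, true_imp_iff, implies_true, and_true]
  grind

/-- The coefficient of the top power of the first variable inherits the leading monomial. -/
theorem IsLeadingMonomialOf.coeff_finSuccEquiv {F : Type*} [CommSemiring F] {n i : ℕ}
    {d : Fin n →₀ ℕ} {q : MvPolynomial (Fin (n + 1)) F}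
    (h : IsLeadingMonomialOf LexLtFin (d.cons i) q) :
    IsLeadingMonomialOf LexLtFin d ((MvPolynomial.finSuccEquiv F n q).coeff i) ∧
      (MvPolynomial.finSuccEquiv F n q).natDegree ≤ i := by
  refine ⟨⟨?_, fun e he hne => ?_⟩, ?_⟩
  · rw [MvPolynomial.mem_support_iff, MvPolynomial.finSuccEquiv_coeff_coeff]
    exact MvPolynomial.mem_support_iff.mp h.1
  · rw [MvPolynomial.mem_support_iff, MvPolynomial.finSuccEquiv_coeff_coeff] at he
    have := h.2 (e.cons i) (MvPolynomial.mem_support_iff.mpr he)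
      fun heq => hne (by simpa using congrArg Finsupp.tail heq)
    simpa [lexLtFin_cons] using this
  · rw [Polynomial.natDegree_le_iff_coeff_eq_zero]
    intro j hj
    ext e
    rw [MvPolynomial.finSuccEquiv_coeff_coeff, MvPolynomial.coeff_zero]
    by_contra hc
    have := h.2 (e.cons j) (MvPolynomial.mem_support_iff.mpr hc)
      fun heq => hj.ne (by simpa using (congrArg (fun a => a 0) heq).symm)
    rw [lexLtFin_cons] at this
    omega

theorem IsLeadingMonomialOf.ne_zero {σ F : Type*} [CommSemiring F]
    {r : (σ →₀ ℕ) → (σ →₀ ℕ) → Prop} {d : σ →₀ ℕ} {p : MvPolynomial σ F}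
    (h : IsLeadingMonomialOf r d p) : p ≠ 0 :=
  MvPolynomial.support_nonempty.mp ⟨d, h.1⟩

/-- If an `x_1`-free monomial is reducible modulo `I(V)`, then it is reducible modulo the ideal of
the projection of `V` that forgets the first coordinate. -/
theorem Reducible.of_cons_zero {F : Type*} [Field F] {n : ℕ} {V : Set (Fin (n + 1) → F)}
    {d : Fin n →₀ ℕ} (h : Reducible LexLtFin (vanishingIdeal V) (d.cons 0)) :
    Reducible LexLtFin (vanishingIdeal {y | ∃ a, Fin.cons a y ∈ V}) d := by
  obtain ⟨q, hq, -, hlead⟩ := h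
  obtain ⟨hlead', hdeg⟩ := hlead.coeff_finSuccEquiv
  refine ⟨_, ?_, hlead'.ne_zero, hlead'⟩
  rintro y ⟨a, ha⟩
  have := hq _ ha
  rw [MvPolynomial.eval_eq_eval_mv_eval', Polynomial.eq_C_of_natDegree_le_zero hdeg] at this
  simpa using this

/-- If `x_1 m` with `m` free of `x_1` is reducible modulo `I(V)`, then `m` is reducible modulo the
ideal of the intersection of the two fibres of `V` over the values of the first coordinate. -/
theorem Reducible.of_cons_one {F : Type*} [Field F] {n : ℕ} {V : Set (Fin (n + 1) → F)}
    {d : Fin n →₀ ℕ} (h : Reducible LexLtFin (vanishingIdeal V) (d.cons 1)) :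
    Reducible LexLtFin (vanishingIdeal {y | Fin.cons 0 y ∈ V ∧ Fin.cons 1 y ∈ V}) d := by
  obtain ⟨q, hq, -, hlead⟩ := h
  obtain ⟨hlead', hdeg⟩ := hlead.coeff_finSuccEquiv
  refine ⟨_, ?_, hlead'.ne_zero, hlead'⟩
  rintro y ⟨h0, h1⟩
  have e0 := hq _ h0
  have e1 := hq _ h1
  rw [MvPolynomial.eval_eq_eval_mv_eval', Polynomial.eq_X_add_C_of_natDegree_le_one hdeg] at e0 e1
  simp at e0 e1
  simpa [e0] using e1

/-- Every integer-valued function on a set of `0`-`1` points is an integer combination of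
irreducible monomials. -/
theorem exists_integer_combination_irreducible {F : Type*} [Field F] {n : ℕ}
    (V : Set (Fin n → F)) (hV : ∀ x ∈ V, ∀ i : Fin n, x i = 0 ∨ x i = 1)
    (f : (Fin n → F) → F) (hf : ∀ x ∈ V, f x ∈ (Int.castRingHom F).range) :
    ∃ P : MvPolynomial (Fin n) F, (∀ x ∈ V, MvPolynomial.eval x P = f x) ∧
      (∀ d ∈ P.support, ¬ Reducible LexLtFin (vanishingIdeal V) d) ∧
      ∀ d, P.coeff d ∈ (Int.castRingHom F).range := by
  classical
  induction n with
  | zero =>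
    rcases V.eq_empty_or_nonempty with rfl | ⟨x, hx⟩
    · exact ⟨0, by simp, by simp, by simp [zero_mem]⟩
    · refine ⟨MvPolynomial.C (f x), fun y _ => ?_, fun d _ => ?_, fun d => ?_⟩
      · rw [MvPolynomial.eval_C, Subsingleton.elim x y]
      · rintro ⟨q, hq, hq0, -⟩
        apply hq0
        rw [MvPolynomial.eq_C_of_isEmpty q]
        have := hq x hx
        rw [MvPolynomial.eq_C_of_isEmpty q, MvPolynomial.eval_C] at this
        rw [this, map_zero]
      · rw [Subsingleton.elim d 0, MvPolynomial.coeff_zero_C]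
        exact hf x hx
  | succ n ih =>
    obtain ⟨Q, hQ, hQirr, hQint⟩ := ih {y | Fin.cons 0 y ∈ V ∧ Fin.cons 1 y ∈ V}
      (fun y hy i => by simpa using hV _ hy.1 i.succ)
      (fun y => f (Fin.cons 1 y) - f (Fin.cons 0 y))
      (fun y hy => sub_mem (hf _ hy.2) (hf _ hy.1))
    obtain ⟨R, hR, hRirr, hRint⟩ := ih {y | ∃ a, Fin.cons a y ∈ V}
      (fun y ⟨a, ha⟩ i => by simpa using hV _ ha i.succ)
      (fun y => if Fin.cons 0 y ∈ V then f (Fin.cons 0 y)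
        else f (Fin.cons 1 y) - MvPolynomial.eval y Q)
      (by
        rintro y ⟨a, ha⟩
        split_ifs with h0
        · exact hf _ h0
        · have ha1 : a = 0 ∨ a = 1 := by simpa using hV _ ha 0
          obtain rfl := ha1.resolve_left fun h => h0 (h ▸ ha)
          refine sub_mem (hf _ ha) (MvPolynomial.eval_mem (fun _ _ => hQint _) fun i => ?_)
          have hy : y i = 0 ∨ y i = 1 := by simpa using hV _ ha i.succ
          rcases hy with h | h <;> rw [h]
          exacts [zero_mem _, one_mem _])
    let P := (MvPolynomial.finSuccEquiv F n).symm
      (Polynomial.C Q * Polynomial.X + Polynomial.C R)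
    have hP : MvPolynomial.finSuccEquiv F n P =
      Polynomial.C Q * Polynomial.X + Polynomial.C R := AlgEquiv.apply_symm_apply _ _
    have hcoeff : ∀ (i : ℕ) (d : Fin n →₀ ℕ), P.coeff (d.cons i) =
        if i = 0 then R.coeff d else if i = 1 then Q.coeff d else 0 := by
      intro i d
      rw [← MvPolynomial.finSuccEquiv_coeff_coeff, hP]
      rcases i with _ | _ | i <;> simp [Polynomial.coeff_X, Polynomial.coeff_C]
    refine ⟨P, fun x hx => ?_, fun d hd hred => ?_, fun d => ?_⟩
    · obtain ⟨a, y, rfl⟩ : ∃ a y, x = Fin.cons a y := ⟨x 0, Fin.tail x, by simp⟩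
      have ha : a = 0 ∨ a = 1 := by simpa using hV _ hx 0
      rw [MvPolynomial.eval_eq_eval_mv_eval', hP]
      simp only [Polynomial.map_add, Polynomial.map_mul, Polynomial.map_C, Polynomial.map_X,
        Polynomial.eval_add, Polynomial.eval_mul, Polynomial.eval_C, Polynomial.eval_X]
      rw [hR y ⟨a, hx⟩]
      rcases ha with rfl | rfl
      · simp [hx]
      · split_ifs with h0
        · rw [hQ y ⟨h0, hx⟩]; ring
        · ring
    · rw [← Finsupp.cons_tail d] at hd hred
      rw [MvPolynomial.mem_support_iff, hcoeff] at hd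
      split_ifs at hd with h0 h1
      · rw [h0] at hred
        exact hRirr _ (MvPolynomial.mem_support_iff.mpr hd) hred.of_cons_zero
      · rw [h1] at hred
        exact hQirr _ (MvPolynomial.mem_support_iff.mpr hd) hred.of_cons_one
      · exact hd rfl
    · rw [← Finsupp.cons_tail d, hcoeff]
      split_ifs
      exacts [hRint _, hQint _, zero_mem _]

/-- **Integrality lemma.** If `F` has characteristic zero and `V ⊆ {0,1}^n`, then the
reduction of any monomial modulo the vanishing ideal `I(V)`, with respect to the
lexicographic order induced by `x_1 ≻ ... ≻ x_n`, has integer coefficients. -/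
theorem integer_reduction {F : Type*} [Field F] [CharZero F] {n : ℕ}
    (V : Set (Fin n → F)) (hV : ∀ x ∈ V, ∀ i : Fin n, x i = 0 ∨ x i = 1)
    (d : Fin n →₀ ℕ) (red : MvPolynomial (Fin n) F)
    (hred : IsReductionOf LexLtFin (vanishingIdeal V) (MvPolynomial.monomial d 1) red) :
    ∀ e : Fin n →₀ ℕ, red.coeff e ∈ Set.range (Int.cast : ℤ → F) := by
  obtain ⟨P, hP, hirr, hint⟩ := exists_integer_combination_irreducible V hV
    (fun x => MvPolynomial.eval x (MvPolynomial.monomial d 1)) fun x hx => by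
      rw [MvPolynomial.eval_monomial, one_mul]
      refine prod_mem fun i _ => pow_mem ?_ _
      rcases hV x hx i with h | h <;> rw [h]
      exacts [zero_mem _, one_mem _]
  have hPred : IsReductionOf LexLtFin (vanishingIdeal V) (MvPolynomial.monomial d 1) P :=
    ⟨fun x hx => by rw [map_sub, hP x hx, sub_self], hirr⟩
  rw [hred.unique hPred]
  exact hint
end
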